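/- arXiv:2407.20994 — 3 statements merged into one kernel-verified Lean document; each statement's English description precedes it below -/
import Mathlib

section
/- Let W and W̃ be good-enough weight matrices of size N on the same interval, with MOP sequences {P_n} and {P̃_n}, and suppose V and N' are N×N matrix differential operators with polynomial coefficients satisfying P_n·V = A_n·P̃_n and P̃_n·N' = Ã_n·P_n for all n ≥ 0, with A_n and Ã_n invertible for all but finitely many n. Then: (i) for every D ∈ D(W) with P_n·D = Λ_n(D)P_n, the composition N'∘D∘V belongs to D(W̃), with P̃_n·(N'∘D∘V) = Ã_n Λ_n(D) A_n · P̃_n for all n; (ii) for every D̃ ∈ D(W̃) with P̃_n·D̃ = Λ_n(D̃)P̃_n, the composition V∘D̃∘N' belongs to D(W), with P_n·(V∘D̃∘N') = A_n Λ_n(D̃) Ã_n · P_n for all n. In particular V∘D(W̃)∘N' ⊆ D(W) and N'∘D(W)∘V ⊆ D(W̃). -/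
open MeasureTheory Filter Polynomial Matrix
open scoped ComplexOrder

noncomputable section

/-- A matrix polynomial. -/
abbrev MatPoly (n m : ℕ) := Matrix (Fin n) (Fin m) (Polynomial ℂ)

/-- Evaluation of a matrix polynomial at a real point. -/
def evalM {n m : ℕ} (P : MatPoly n m) (x : ℝ) : Matrix (Fin n) (Fin m) ℂ :=
  Matrix.of fun i j => (P i j).eval (x : ℂ)

/-- Entrywise `j`-th derivative of a matrix polynomial. -/
def derivM {n m : ℕ} (j : ℕ) (P : MatPoly n m) : MatPoly n m :=
  Matrix.of fun i k => (⇑Polynomial.derivative)^[j] (P i k)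

/-- A constant matrix, viewed as a matrix polynomial. -/
def cmap {n m : ℕ} (A : Matrix (Fin n) (Fin m) ℂ) : MatPoly n m :=
  A.map Polynomial.C

/-- A matrix differential operator with polynomial coefficients,
`D = ∑_{j ≤ order} ∂^j F_j`, acting on the right. -/
structure MatDiffOp (n m : ℕ) where
  order : ℕ
  coeff : ℕ → MatPoly n m
  coeff_eq_zero : ∀ j, order < j → coeff j = 0

/-- The right action `(P · D)(x) = ∑_j P^{(j)}(x) F_j(x)`. -/
def MatDiffOp.act {k n m : ℕ} (P : MatPoly k n) (D : MatDiffOp n m) : MatPoly k m :=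
  ∑ j ∈ Finset.range (D.order + 1), derivM j P * D.coeff j

/-- The action `f · D = ∑_j f^{(j)} F_j` on a scalar polynomial. -/
def MatDiffOp.sact {n m : ℕ} (D : MatDiffOp n m) (f : Polynomial ℂ) : MatPoly n m :=
  ∑ j ∈ Finset.range (D.order + 1), ((⇑Polynomial.derivative)^[j] f) • D.coeff j

/-- A weight matrix on the set `s`: smooth, a.e. positive definite, with finite moments. -/
structure IsWeight (s : Set ℝ) {N : ℕ} (W : ℝ → Matrix (Fin N) (Fin N) ℂ) : Prop where
  smooth : ∀ i j, ContDiffOn ℝ (⊤ : ℕ∞) (fun x => W x i j) s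
  posdef : ∀ᵐ x ∂(volume.restrict s), (W x).PosDef
  moments : ∀ (k : ℕ) (i j : Fin N), IntegrableOn (fun x : ℝ => (x : ℂ) ^ k * W x i j) s

/-- `∑_j W^{(j)}(x) F_j(x)` for a differential operator `D` with coefficients `F_j`. -/
def weightSide {N : ℕ} (W : ℝ → Matrix (Fin N) (Fin N) ℂ) (D : MatDiffOp N N) (x : ℝ) :
    Matrix (Fin N) (Fin N) ℂ :=
  ∑ j ∈ Finset.range (D.order + 1),
    (Matrix.of fun i k => iteratedDeriv j (fun t => W t i k) x) * evalM (D.coeff j) x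

/-- The weight `W` is good enough. -/
def GoodEnough (s : Set ℝ) {N : ℕ} (W : ℝ → Matrix (Fin N) (Fin N) ℂ) : Prop :=
  ∀ (A : MatPoly N N) (D : MatDiffOp N N),
    (∀ (P : MatPoly N N) (i j : Fin N),
        IntegrableOn (fun x => (evalM P x * (evalM A x * W x)) i j) s ∧
        IntegrableOn (fun x => (evalM P x * weightSide W D x) i j) s ∧
        ∫ x in s, (evalM P x * (evalM A x * W x)) i j =
          ∫ x in s, (evalM P x * weightSide W D x) i j) →
    ∀ x ∈ s, evalM A x * W x = weightSide W D x

/-- The matrix inner product `⟨P, Q⟩_W = ∫ P W Q^*`. -/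
def innerW (s : Set ℝ) {N a b : ℕ} (W : ℝ → Matrix (Fin N) (Fin N) ℂ)
    (P : MatPoly a N) (Q : MatPoly b N) : Matrix (Fin a) (Fin b) ℂ :=
  Matrix.of fun i j => ∫ x in s, (evalM P x * W x * (evalM Q x)ᴴ) i j

/-- A sequence of matrix orthogonal polynomials with respect to `W` on `s`. -/
structure IsMOP (s : Set ℝ) {N : ℕ} (W : ℝ → Matrix (Fin N) (Fin N) ℂ)
    (P : ℕ → MatPoly N N) : Prop where
  degree_le : ∀ n (i j : Fin N), ((P n) i j).natDegree ≤ n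
  lead_unit : ∀ n, IsUnit (Matrix.of fun i j : Fin N => ((P n) i j).coeff n)
  integrable : ∀ n m (i j : Fin N),
    IntegrableOn (fun x => (evalM (P n) x * W x * (evalM (P m) x)ᴴ) i j) s
  orthogonal : ∀ n m, n ≠ m → innerW s W (P n) (P m) = 0

/-- Membership in the algebra `𝒟(W)` (relative to the MOP sequence `P`). -/
def InDW {N : ℕ} (P : ℕ → MatPoly N N) (D : MatDiffOp N N) : Prop :=
  ∀ n, ∃ Λ : Matrix (Fin N) (Fin N) ℂ, MatDiffOp.act (P n) D = cmap Λ * P n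

/-- Membership in the module `𝒟(W, W̃)` (relative to the MOP sequences `P`, `Q`). -/
def InDWW {N1 N2 : ℕ} (P : ℕ → MatPoly N1 N1) (Q : ℕ → MatPoly N2 N2)
    (T : MatDiffOp N1 N2) : Prop :=
  ∀ n, ∃ A : Matrix (Fin N1) (Fin N2) ℂ, MatDiffOp.act (P n) T = cmap A * Q n

/-- A matrix polynomial has degree (exactly) `d`. -/
def hasDeg {n m : ℕ} (P : MatPoly n m) (d : ℕ) : Prop :=
  (∀ i j, (P i j).degree ≤ (d : WithBot ℕ)) ∧ ∃ i j, (P i j).degree = (d : WithBot ℕ)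

/-- A degree-preserving differential operator. -/
def DegreePreserving {n m : ℕ} (D : MatDiffOp n m) : Prop :=
  ∀ᶠ d in (atTop : Filter ℕ), ∀ f : Polynomial ℂ, f.degree = ((d : ℕ) : WithBot ℕ) → hasDeg (D.sact f) d

/-- `Q` is a Darboux transformation of `P`. -/
def IsDarboux {N : ℕ} (P Q : ℕ → MatPoly N N) : Prop :=
  ∃ (V Nop D : MatDiffOp N N) (A : ℕ → Matrix (Fin N) (Fin N) ℂ),
    DegreePreserving V ∧ DegreePreserving Nop ∧
    (∀ R : MatPoly N N, MatDiffOp.act R D = MatDiffOp.act (MatDiffOp.act R V) Nop) ∧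
    InDW P D ∧
    (∀ n, MatDiffOp.act (P n) V = cmap (A n) * Q n)
namespace MatDiffOp

variable {k l n m : ℕ}

lemma derivM_derivM (i j : ℕ) (P : MatPoly n m) : derivM i (derivM j P) = derivM (i + j) P := by
  ext1 a b
  simp [derivM, Function.iterate_add_apply]

lemma derivM_sum {ι : Type*} (i : ℕ) (t : Finset ι) (f : ι → MatPoly n m) :
    derivM i (∑ j ∈ t, f j) = ∑ j ∈ t, derivM i (f j) := by
  ext1 a b
  simp [derivM, Matrix.sum_apply, Polynomial.iterate_derivative_sum]

/-- The Leibniz rule for matrix polynomials. -/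
lemma derivM_mul (i : ℕ) (P : MatPoly k n) (Q : MatPoly n m) :
    derivM i (P * Q) =
      ∑ j ∈ Finset.range i.succ, derivM (i - j) P * (i.choose j • derivM j Q) := by
  ext1 a b
  simp only [derivM, Matrix.of_apply, Matrix.mul_apply, Polynomial.iterate_derivative_sum,
    Polynomial.iterate_derivative_mul, Matrix.sum_apply, Matrix.smul_apply, mul_smul_comm]
  exact Finset.sum_comm

lemma derivM_cmap_mul (i : ℕ) (A : Matrix (Fin k) (Fin n) ℂ) (P : MatPoly n m) :
    derivM i (cmap A * P) = cmap A * derivM i P := by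
  ext1 a b
  simp [derivM, cmap, Matrix.mul_apply, Polynomial.iterate_derivative_sum,
    Polynomial.iterate_derivative_C_mul]

lemma act_cmap_mul (A : Matrix (Fin l) (Fin k) ℂ) (P : MatPoly k n) (D : MatDiffOp n m) :
    act (cmap A * P) D = cmap A * act P D := by
  simp only [act, derivM_cmap_mul, Matrix.mul_assoc, Matrix.mul_sum]

lemma cmap_mul (A : Matrix (Fin k) (Fin n) ℂ) (B : Matrix (Fin n) (Fin m) ℂ) :
    cmap (A * B) = cmap A * cmap B :=
  Matrix.map_mul

/-- The action of a finitely supported family of coefficients, as an additive map. -/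
def coeffAction (k n m : ℕ) : (ℕ →₀ MatPoly n m) →+ (MatPoly k n → MatPoly k m) :=
  Finsupp.liftAddHom fun j =>
    { toFun := fun F R => derivM j R * F
      map_zero' := by ext1 R; simp
      map_add' := fun F G => by ext1 R; simp [Matrix.mul_add] }

lemma exists_act_eq_of_mem_range {T : MatPoly k n → MatPoly k m}
    (hT : T ∈ AddMonoidHom.mrange (coeffAction k n m)) :
    ∃ D : MatDiffOp n m, ∀ R, act R D = T R := by
  obtain ⟨F, rfl⟩ := hT
  have hF : ∀ j ∈ F.support, j ≤ F.support.sup id := fun j hj => Finset.le_sup (f := id) hj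
  refine ⟨⟨F.support.sup id, F, fun j hj => ?_⟩, fun R => ?_⟩
  · by_contra h
    exact absurd (hF j (Finsupp.mem_support_iff.2 h)) (by omega)
  · simp only [act, coeffAction, Finsupp.liftAddHom_apply, Finsupp.sum, Finset.sum_apply,
      AddMonoidHom.coe_mk, ZeroHom.coe_mk]
    refine (Finset.sum_subset (fun j hj => ?_) fun j _ hj => ?_).symm
    · exact Finset.mem_range.2 (Nat.lt_succ_of_le (hF j hj))
    · simp [Finsupp.notMem_support_iff.1 hj]

lemma single_mem_range (j : ℕ) (F : MatPoly n m) :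
    (fun R : MatPoly k n => derivM j R * F) ∈ AddMonoidHom.mrange (coeffAction k n m) :=
  ⟨Finsupp.single j F, Finsupp.liftAddHom_apply_single _ _ _⟩

/-- The composition of two differential operators is a differential operator. -/
lemma exists_act_comp (D : MatDiffOp n m) (E : MatDiffOp m l) :
    ∃ F : MatDiffOp n l, ∀ R : MatPoly k n, act R F = act (act R D) E := by
  refine exists_act_eq_of_mem_range ?_
  have h : (fun R : MatPoly k n => act (act R D) E) =
      ∑ i ∈ Finset.range (E.order + 1), ∑ j ∈ Finset.range (D.order + 1),
        ∑ a ∈ Finset.range i.succ, fun R : MatPoly k n =>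
          derivM (i - a + j) R * ((i.choose a • derivM a (D.coeff j)) * E.coeff i) := by
    ext1 R
    simp only [act, derivM_sum, derivM_mul, derivM_derivM, Matrix.sum_mul, Finset.sum_apply,
      Matrix.mul_assoc]
  rw [h]
  exact sum_mem fun i _ => sum_mem fun j _ => sum_mem fun a _ => single_mem_range _ _

/-- Conjugating an operator with eigenvalues `Λ` by operators intertwining `P` and `Q`. -/
lemma act_conj {P Q : ℕ → MatPoly n n} {V M D : MatDiffOp n n}
    {A B Λ : ℕ → Matrix (Fin n) (Fin n) ℂ}
    (hV : ∀ i, act (P i) V = cmap (A i) * Q i) (hM : ∀ i, act (Q i) M = cmap (B i) * P i)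
    (hD : ∀ i, act (P i) D = cmap (Λ i) * P i) (i : ℕ) :
    act (act (act (Q i) M) D) V = cmap (B i * Λ i * A i) * Q i := by
  rw [hM, act_cmap_mul, hD, act_cmap_mul, act_cmap_mul, hV]
  simp only [cmap_mul, Matrix.mul_assoc]

/-- The conjugated operator exists and has `Q` as eigenfunctions. -/
lemma exists_conj {P Q : ℕ → MatPoly n n} {V M D : MatDiffOp n n}
    {A B Λ : ℕ → Matrix (Fin n) (Fin n) ℂ}
    (hV : ∀ i, act (P i) V = cmap (A i) * Q i) (hM : ∀ i, act (Q i) M = cmap (B i) * P i)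
    (hD : ∀ i, act (P i) D = cmap (Λ i) * P i) :
    ∃ E : MatDiffOp n n, (∀ R : MatPoly n n, act R E = act (act (act R M) D) V) ∧ InDW Q E := by
  obtain ⟨F, hF⟩ := exists_act_comp (k := n) M D
  obtain ⟨E, hE⟩ := exists_act_comp (k := n) F V
  have h : ∀ R : MatPoly n n, act R E = act (act (act R M) D) V := fun R => by rw [hE, hF]
  exact ⟨E, h, fun i => ⟨_, (h _).trans (act_conj hV hM hD i)⟩⟩

end MatDiffOp

/-- conjugation of the algebras by the Darboux operators. -/
theorem statement_4 {N : ℕ} (s : Set ℝ) (hs : IsOpen s) (hconn : s.OrdConnected)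
    (W Wt : ℝ → Matrix (Fin N) (Fin N) ℂ)
    (hW : IsWeight s W) (hWgood : GoodEnough s W)
    (hWt : IsWeight s Wt) (hWtgood : GoodEnough s Wt)
    (P Pt : ℕ → MatPoly N N) (hP : IsMOP s W P) (hPt : IsMOP s Wt Pt)
    (V Nop : MatDiffOp N N) (A At : ℕ → Matrix (Fin N) (Fin N) ℂ)
    (hV : ∀ n, MatDiffOp.act (P n) V = cmap (A n) * Pt n)
    (hN : ∀ n, MatDiffOp.act (Pt n) Nop = cmap (At n) * P n)
    (hA : ∀ᶠ n in (atTop : Filter ℕ), IsUnit (A n))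
    (hAt : ∀ᶠ n in (atTop : Filter ℕ), IsUnit (At n)) :
    (∀ (D : MatDiffOp N N) (Λ : ℕ → Matrix (Fin N) (Fin N) ℂ),
      (∀ n, MatDiffOp.act (P n) D = cmap (Λ n) * P n) →
      (∀ n, MatDiffOp.act (MatDiffOp.act (MatDiffOp.act (Pt n) Nop) D) V
          = cmap (At n * Λ n * A n) * Pt n) ∧
      ∃ E : MatDiffOp N N,
        (∀ R : MatPoly N N,
          MatDiffOp.act R E = MatDiffOp.act (MatDiffOp.act (MatDiffOp.act R Nop) D) V) ∧
        InDW Pt E) ∧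
    (∀ (Dt : MatDiffOp N N) (Λ : ℕ → Matrix (Fin N) (Fin N) ℂ),
      (∀ n, MatDiffOp.act (Pt n) Dt = cmap (Λ n) * Pt n) →
      (∀ n, MatDiffOp.act (MatDiffOp.act (MatDiffOp.act (P n) V) Dt) Nop
          = cmap (A n * Λ n * At n) * P n) ∧
      ∃ E : MatDiffOp N N,
        (∀ R : MatPoly N N,
          MatDiffOp.act R E = MatDiffOp.act (MatDiffOp.act (MatDiffOp.act R V) Dt) Nop) ∧
        InDW P E) := by
  exact ⟨fun _ _ hD => ⟨MatDiffOp.act_conj hV hN hD, MatDiffOp.exists_conj hV hN hD⟩,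
    fun _ _ hD => ⟨MatDiffOp.act_conj hN hV hD, MatDiffOp.exists_conj hN hV hD⟩⟩
end
end

section
/- Let W and W̃ be good-enough weight matrices of sizes N1 and N2 on the same interval, with MOP sequences {P_n} and {P̃_n}. If V ∈ D(W, W̃), then there exists an N2×N1 matrix differential operator V† with polynomial coefficients such that ⟨P·V, Q⟩_{W̃} = ⟨P, Q·V†⟩_W for all N1×N1 matrix polynomials P and N2×N2 matrix polynomials Q (i.e., V† realizes the formal adjoint W̃ V^* W^{−1}), and V† belongs to D(W̃, W). -/
open MeasureTheory Filter Polynomial Matrix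
open scoped ComplexOrder

noncomputable section

/-- The action of `∂^j F` on rows of polynomials. -/
def rowTerm {n m : ℕ} (j : ℕ) (F : MatPoly n m) : (Fin n → ℂ[X]) →ₗ[ℂ] (Fin m → ℂ[X]) where
  toFun p := Matrix.vecMul (fun a => (⇑Polynomial.derivative)^[j] (p a)) F
  map_add' p q := by
    ext1 k
    simp [Matrix.vecMul, dotProduct, iterate_map_add, add_mul,
      Finset.sum_add_distrib]
  map_smul' c p := by
    ext1 k
    simp [Matrix.vecMul, dotProduct, Polynomial.iterate_derivative_smul, Finset.smul_sum]

lemma rowTerm_apply {n m : ℕ} (j : ℕ) (F : MatPoly n m) (p : Fin n → ℂ[X]) (k : Fin m) :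
    rowTerm j F p k = ∑ a, (⇑Polynomial.derivative)^[j] (p a) * F a k := rfl

lemma rowTerm_smul {n m : ℕ} (j : ℕ) (c : ℂ) (F : MatPoly n m) :
    rowTerm j (c • F) = c • rowTerm j F := by
  refine LinearMap.ext fun p => funext fun k => ?_
  simp [rowTerm_apply, Finset.smul_sum]

/-- The action of a matrix differential operator on rows of polynomials. -/
def MatDiffOp.rowAct {n m : ℕ} (D : MatDiffOp n m) :
    (Fin n → ℂ[X]) →ₗ[ℂ] (Fin m → ℂ[X]) :=
  ∑ j ∈ Finset.range (D.order + 1), rowTerm j (D.coeff j)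

lemma MatDiffOp.act_row {k n m : ℕ} (P : MatPoly k n) (D : MatDiffOp n m) (i : Fin k) :
    MatDiffOp.act P D i = D.rowAct (P i) := by
  ext1 l
  simp [MatDiffOp.act, MatDiffOp.rowAct, Matrix.sum_apply, Matrix.mul_apply, rowTerm_apply, derivM]

/-- Multiplication by the variable on rows of polynomials. -/
def mulX (n : ℕ) : (Fin n → ℂ[X]) →ₗ[ℂ] (Fin n → ℂ[X]) :=
  Algebra.lsmul ℂ ℂ (Fin n → ℂ[X]) (X : ℂ[X])

lemma mulX_apply {n : ℕ} (p : Fin n → ℂ[X]) (a : Fin n) : mulX n p a = X * p a := rfl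

/-- The commutator with multiplication by the variable. -/
def adX (n m : ℕ) : Module.End ℂ ((Fin n → ℂ[X]) →ₗ[ℂ] (Fin m → ℂ[X])) where
  toFun T := T ∘ₗ mulX n - mulX m ∘ₗ T
  map_add' S T := by
    rw [LinearMap.add_comp, LinearMap.comp_add]; abel
  map_smul' c T := by
    rw [LinearMap.smul_comp, LinearMap.comp_smul, RingHom.id_apply, smul_sub]

lemma adX_apply {n m : ℕ} (T : (Fin n → ℂ[X]) →ₗ[ℂ] (Fin m → ℂ[X])) (p : Fin n → ℂ[X]) :
    adX n m T p = T (mulX n p) - mulX m (T p) := rfl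

lemma adX_rowTerm_zero {n m : ℕ} (F : MatPoly n m) : adX n m (rowTerm 0 F) = 0 := by
  refine LinearMap.ext fun p => funext fun k => ?_
  simp [adX_apply, rowTerm_apply, mulX_apply, Finset.mul_sum, mul_assoc]

lemma adX_rowTerm_succ {n m : ℕ} (j : ℕ) (F : MatPoly n m) :
    adX n m (rowTerm (j + 1) F) = ((j : ℂ) + 1) • rowTerm j F := by
  refine LinearMap.ext fun p => funext fun k => ?_
  simp only [adX_apply, rowTerm_apply, mulX_apply, Pi.sub_apply, LinearMap.smul_apply,
    Pi.smul_apply, Finset.mul_sum, Finset.smul_sum, ← Finset.sum_sub_distrib]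
  refine Finset.sum_congr rfl fun a _ => ?_
  rw [mul_comm X (p a), Polynomial.iterate_derivative_mul_X, Polynomial.smul_eq_C_mul]
  simp
  ring

lemma adX_pow_rowTerm {n m : ℕ} (t : ℕ) : ∀ (j : ℕ) (F : MatPoly n m), j < t →
    (adX n m ^ t) (rowTerm j F) = 0 := by
  induction t with
  | zero => intro j F h; omega
  | succ t ih =>
    intro j F h
    rw [pow_succ, Module.End.mul_apply]
    cases j with
    | zero => rw [adX_rowTerm_zero, map_zero]
    | succ j => rw [adX_rowTerm_succ, map_smul, ih j F (by omega), smul_zero]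

lemma MatDiffOp.adX_pow_rowAct {n m : ℕ} (D : MatDiffOp n m) :
    (adX n m ^ (D.order + 1)) D.rowAct = 0 := by
  rw [MatDiffOp.rowAct, map_sum]
  exact Finset.sum_eq_zero fun j hj => adX_pow_rowTerm _ _ _ (Finset.mem_range.1 hj)

lemma map_polynomial_smul_of_adX_eq_zero {n m : ℕ} {T : (Fin n → ℂ[X]) →ₗ[ℂ] (Fin m → ℂ[X])}
    (h : adX n m T = 0) (f : ℂ[X]) (p : Fin n → ℂ[X]) : T (f • p) = f • T p := by
  have hX : ∀ p, T ((X : ℂ[X]) • p) = (X : ℂ[X]) • T p := fun p =>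
    sub_eq_zero.1 (LinearMap.congr_fun h p)
  induction f using Polynomial.induction_on generalizing p with
  | C c =>
    have e : ∀ (l : ℕ) (q : Fin l → ℂ[X]), (C c : ℂ[X]) • q = c • q := fun l q => by
      ext1 a; simp [Polynomial.smul_eq_C_mul]
    rw [e, e, map_smul]
  | add f g hf hg => rw [add_smul, add_smul, map_add, hf, hg]
  | monomial k c ih =>
    rw [pow_succ, ← mul_assoc, mul_smul, ih, hX, mul_smul (C c * X ^ k)]

lemma eq_rowTerm_zero_of_adX_eq_zero {n m : ℕ} {T : (Fin n → ℂ[X]) →ₗ[ℂ] (Fin m → ℂ[X])}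
    (h : adX n m T = 0) : T = rowTerm 0 (Matrix.of fun a => T (Pi.single a 1)) := by
  refine LinearMap.ext fun p => funext fun k => ?_
  have hp : p = ∑ a, p a • (Pi.single a 1 : Fin n → ℂ[X]) := by
    ext1 b
    simp [Finset.sum_apply, Pi.single_apply]
  conv_lhs => rw [hp]
  simp [map_sum, map_polynomial_smul_of_adX_eq_zero h, rowTerm_apply]

lemma exists_eq_sum_rowTerm_of_adX_pow_eq_zero {n m : ℕ} (t : ℕ) :
    ∀ T : (Fin n → ℂ[X]) →ₗ[ℂ] (Fin m → ℂ[X]), (adX n m ^ (t + 1)) T = 0 →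
      ∃ F : ℕ → MatPoly n m, T = ∑ j ∈ Finset.range (t + 1), rowTerm j (F j) := by
  induction t with
  | zero =>
    intro T h
    rw [zero_add, pow_one] at h
    exact ⟨fun _ => Matrix.of fun a => T (Pi.single a 1), by
      simpa using eq_rowTerm_zero_of_adX_eq_zero h⟩
  | succ t ih =>
    intro T h
    rw [pow_succ, Module.End.mul_apply] at h
    obtain ⟨G, hG⟩ := ih _ h
    let S := ∑ j ∈ Finset.range (t + 1), rowTerm (j + 1) (((j : ℂ) + 1)⁻¹ • G j)
    have hS : adX n m S = adX n m T := by
      rw [hG, map_sum]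
      refine Finset.sum_congr rfl fun j _ => ?_
      rw [adX_rowTerm_succ, rowTerm_smul, smul_inv_smul₀ (Nat.cast_add_one_ne_zero j)]
    have h0 : adX n m (T - S) = 0 := by rw [map_sub, hS, sub_self]
    have h1 := eq_rowTerm_zero_of_adX_eq_zero h0
    refine ⟨fun j => Nat.casesOn j (Matrix.of fun a => (T - S) (Pi.single a 1))
      fun j => ((j : ℂ) + 1)⁻¹ • G j, ?_⟩
    rw [Finset.sum_range_succ']
    change T = S + rowTerm 0 (Matrix.of fun a => (T - S) (Pi.single a 1))
    rw [← h1]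
    abel

lemma exists_matDiffOp_of_adX_pow_eq_zero {n m : ℕ} (t : ℕ)
    (T : (Fin n → ℂ[X]) →ₗ[ℂ] (Fin m → ℂ[X])) (h : (adX n m ^ (t + 1)) T = 0) :
    ∃ D : MatDiffOp n m, D.rowAct = T := by
  obtain ⟨F, rfl⟩ := exists_eq_sum_rowTerm_of_adX_pow_eq_zero t T h
  refine ⟨⟨t, fun j => if t < j then 0 else F j, fun j hj => if_pos hj⟩,
    Finset.sum_congr rfl fun j hj => ?_⟩
  exact congrArg (rowTerm j) (if_neg (by have := Finset.mem_range.1 hj; omega))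

section Adjoint

variable {E₁ E₂ : Type*} [AddCommGroup E₁] [Module ℂ E₁] [AddCommGroup E₂] [Module ℂ E₂]

lemma exists_represent_on_finite_family (B : E₁ →ₗ[ℂ] E₁ →ₗ⋆[ℂ] ℂ)
    (hB : ∀ p, B p p = 0 → p = 0) {N : ℕ} (b : Fin N → E₁) (hb : LinearIndependent ℂ b)
    (β : Fin N → ℂ) : ∃ c : Fin N → ℂ, ∀ j, B (b j) (∑ l, c l • b l) = β j := by
  let L : (Fin N → ℂ) →ₗ[ℂ] (Fin N → ℂ) :=
    Matrix.mulVecLin (Matrix.of fun j l => B (b j) (b l))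
  have hL : ∀ d j, L d j = B (b j) (∑ l, (starRingEnd ℂ) (d l) • b l) := by
    intro d j
    simp [L, Matrix.mulVec, dotProduct, map_sum, mul_comm]
  have hinj : Function.Injective L := by
    rw [← LinearMap.ker_eq_bot, LinearMap.ker_eq_bot']
    intro d hd
    have h0 : (∑ l, (starRingEnd ℂ) (d l) • b l) = 0 := by
      apply hB
      rw [map_sum B, LinearMap.sum_apply]
      refine Finset.sum_eq_zero fun j _ => ?_
      rw [map_smul, LinearMap.smul_apply, ← hL, hd, Pi.zero_apply, smul_zero]
    ext j
    have := Fintype.linearIndependent_iff.1 hb _ h0 j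
    simpa using this
  obtain ⟨d, hd⟩ := LinearMap.injective_iff_surjective.1 hinj β
  exact ⟨fun l => (starRingEnd ℂ) (d l), fun j => by rw [← hL, hd]⟩

/-- A linear map which is block diagonal with respect to two orthogonal spanning families of finite
blocks has a formal adjoint, which is again block diagonal. -/
lemma exists_adjoint_of_block_diagonal (B₁ : E₁ →ₗ[ℂ] E₁ →ₗ⋆[ℂ] ℂ) (B₂ : E₂ →ₗ[ℂ] E₂ →ₗ⋆[ℂ] ℂ)
    (hB₁ : ∀ p, B₁ p p = 0 → p = 0) {N₁ N₂ : ℕ} (b₁ : ℕ → Fin N₁ → E₁) (b₂ : ℕ → Fin N₂ → E₂)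
    (hli : ∀ n, LinearIndependent ℂ (b₁ n))
    (hspan₁ : ∀ p, p ∈ Submodule.span ℂ {q | ∃ n i, b₁ n i = q})
    (hspan₂ : ∀ p, p ∈ Submodule.span ℂ {q | ∃ n i, b₂ n i = q})
    (horth₁ : ∀ m n i j, m ≠ n → B₁ (b₁ m i) (b₁ n j) = 0)
    (horth₂ : ∀ m n i j, m ≠ n → B₂ (b₂ m i) (b₂ n j) = 0)
    (T : E₁ →ₗ[ℂ] E₂) (hT : ∀ n i, ∃ c : Fin N₂ → ℂ, T (b₁ n i) = ∑ l, c l • b₂ n l) :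
    ∃ S : E₂ →ₗ[ℂ] E₁, (∀ p q, B₂ (T p) q = B₁ p (S q)) ∧
      ∀ n i, ∃ c : Fin N₁ → ℂ, S (b₂ n i) = ∑ l, c l • b₁ n l := by
  have huniq : ∀ r r', (∀ p, B₁ p r = B₁ p r') → r = r' := fun r r' h =>
    sub_eq_zero.1 (hB₁ _ (by rw [map_sub, h, sub_self]))
  have hblock : ∀ n i, ∃ c : Fin N₁ → ℂ, ∀ p, B₂ (T p) (b₂ n i) = B₁ p (∑ l, c l • b₁ n l) := by
    intro n i
    obtain ⟨c, hc⟩ := exists_represent_on_finite_family B₁ hB₁ (b₁ n) (hli n)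
      fun j => B₂ (T (b₁ n j)) (b₂ n i)
    refine ⟨c, fun p => ?_⟩
    induction hspan₁ p using Submodule.span_induction with
    | mem p hp =>
      obtain ⟨m, j, rfl⟩ := hp
      by_cases hmn : m = n
      · subst hmn; exact (hc j).symm
      · obtain ⟨d, hd⟩ := hT m j
        simp [hd, map_sum, LinearMap.sum_apply, horth₁ _ _ _ _ hmn, horth₂ _ _ _ _ hmn]
    | zero => simp
    | add p q _ _ hp hq => simp only [map_add, LinearMap.add_apply, hp, hq]
    | smul a p _ hp => simp only [map_smul, LinearMap.smul_apply, hp]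
  have hex : ∀ q, ∃ r, ∀ p, B₂ (T p) q = B₁ p r := by
    intro q
    induction hspan₂ q using Submodule.span_induction with
    | mem q hq =>
      obtain ⟨n, i, rfl⟩ := hq
      obtain ⟨c, hc⟩ := hblock n i
      exact ⟨_, hc⟩
    | zero => exact ⟨0, by simp⟩
    | add q q' _ _ hq hq' =>
      obtain ⟨r, hr⟩ := hq
      obtain ⟨r', hr'⟩ := hq'
      exact ⟨r + r', fun p => by rw [map_add, map_add, hr, hr']⟩
    | smul a q _ hq =>
      obtain ⟨r, hr⟩ := hq
      exact ⟨a • r, fun p => by rw [map_smulₛₗ, map_smulₛₗ, hr]⟩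
  choose S hS using hex
  refine ⟨{ toFun := S, map_add' := fun q q' => huniq _ _ fun p => ?_,
            map_smul' := fun a q => huniq _ _ fun p => ?_ }, fun p q => hS q p, fun n i => ?_⟩
  · rw [← hS, map_add, map_add, hS, hS]
  · rw [← hS, RingHom.id_apply, map_smulₛₗ, map_smulₛₗ, hS]
  · obtain ⟨c, hc⟩ := hblock n i
    exact ⟨c, huniq _ _ fun p => by rw [← hc]; exact (hS _ p).symm⟩

end Adjoint

lemma adX_pow_adjoint {n m : ℕ} (B₁ : (Fin n → ℂ[X]) →ₗ[ℂ] (Fin n → ℂ[X]) →ₗ⋆[ℂ] ℂ)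
    (B₂ : (Fin m → ℂ[X]) →ₗ[ℂ] (Fin m → ℂ[X]) →ₗ⋆[ℂ] ℂ)
    (hX₁ : ∀ p q, B₁ (mulX n p) q = B₁ p (mulX n q))
    (hX₂ : ∀ p q, B₂ (mulX m p) q = B₂ p (mulX m q)) (t : ℕ) :
    ∀ (T : (Fin n → ℂ[X]) →ₗ[ℂ] (Fin m → ℂ[X])) (S : (Fin m → ℂ[X]) →ₗ[ℂ] (Fin n → ℂ[X])),
      (∀ p q, B₂ (T p) q = B₁ p (S q)) →
      ∀ p q, B₂ ((adX n m ^ t) T p) q = (-1) ^ t * B₁ p ((adX m n ^ t) S q) := by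
  induction t with
  | zero => intro T S h p q; simp [h]
  | succ t ih =>
    intro T S h p q
    have := ih (adX n m T) (-adX m n S) (fun p q => by
      simp only [adX_apply, map_sub, LinearMap.sub_apply, LinearMap.neg_apply, map_neg, h, hX₁, hX₂]
      ring) p q
    rw [pow_succ (adX n m), pow_succ (adX m n), Module.End.mul_apply, Module.End.mul_apply, this]
    simp only [map_neg, LinearMap.neg_apply]
    ring

section Weight

variable {s : Set ℝ} {N : ℕ} {W : ℝ → Matrix (Fin N) (Fin N) ℂ}

/-- The integrand `p W q^*` for rows of polynomials. -/
def rowIntegrand (W : ℝ → Matrix (Fin N) (Fin N) ℂ) (p q : Fin N → ℂ[X]) (x : ℝ) : ℂ :=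
  ∑ b, (∑ a, (p a).eval (x : ℂ) * W x a b) * star ((q b).eval (x : ℂ))

lemma star_eval_ofReal (q : ℂ[X]) (x : ℝ) :
    star (q.eval (x : ℂ)) = (q.map (starRingEnd ℂ)).eval (x : ℂ) := by
  rw [Polynomial.eval_map, Polynomial.eval₂_eq_sum_range, Polynomial.eval_eq_sum_range]
  simp

lemma IsWeight.integrableOn_eval_mul (hW : IsWeight s W) (f : ℂ[X]) (a b : Fin N) :
    IntegrableOn (fun x : ℝ => f.eval (x : ℂ) * W x a b) s := by
  induction f using Polynomial.induction_on' with
  | add f g hf hg => simpa [add_mul] using! hf.add hg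
  | monomial k c => simpa [mul_assoc] using! (hW.moments k a b).const_mul c

lemma IsWeight.integrableOn_rowIntegrand (hW : IsWeight s W) (p q : Fin N → ℂ[X]) :
    IntegrableOn (rowIntegrand W p q) s := by
  have : rowIntegrand W p q = fun x : ℝ =>
      ∑ b, ∑ a, (p a * (q b).map (starRingEnd ℂ)).eval (x : ℂ) * W x a b := by
    ext x
    simp only [rowIntegrand, star_eval_ofReal, Finset.sum_mul, Polynomial.eval_mul]
    exact Finset.sum_congr rfl fun b _ => Finset.sum_congr rfl fun a _ => by ring
  rw [this]
  exact integrable_finsetSum _ fun b _ => integrable_finsetSum _ fun a _ =>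
    hW.integrableOn_eval_mul _ a b

/-- The sesquilinear form `∫ p W q^*` on rows of polynomials. -/
def IsWeight.rowForm (hW : IsWeight s W) :
    (Fin N → ℂ[X]) →ₗ[ℂ] (Fin N → ℂ[X]) →ₗ⋆[ℂ] ℂ :=
  LinearMap.mk₂'ₛₗ (RingHom.id ℂ) (starRingEnd ℂ) (fun p q => ∫ x in s, rowIntegrand W p q x)
    (fun p p' q => by
      rw [← integral_add (hW.integrableOn_rowIntegrand p q) (hW.integrableOn_rowIntegrand p' q)]
      congr 1; ext x
      simp [rowIntegrand, add_mul, Finset.sum_add_distrib])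
    (fun c p q => by
      rw [smul_eq_mul, ← integral_const_mul]
      congr 1; ext x
      simp only [rowIntegrand, Finset.mul_sum, Finset.sum_mul]
      exact Finset.sum_congr rfl fun b _ => Finset.sum_congr rfl fun a _ => by simp; ring)
    (fun p q q' => by
      rw [← integral_add (hW.integrableOn_rowIntegrand p q) (hW.integrableOn_rowIntegrand p q')]
      congr 1; ext x
      simp [rowIntegrand, mul_add, Finset.sum_add_distrib])
    (fun c p q => by
      rw [smul_eq_mul, ← integral_const_mul]
      congr 1; ext x
      simp only [rowIntegrand, Finset.mul_sum, Finset.sum_mul]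
      exact Finset.sum_congr rfl fun b _ => Finset.sum_congr rfl fun a _ => by simp; ring)

lemma IsWeight.rowForm_apply (hW : IsWeight s W) (p q : Fin N → ℂ[X]) :
    hW.rowForm p q = ∫ x in s, rowIntegrand W p q x := rfl

lemma IsWeight.innerW_apply (hW : IsWeight s W) {a b : ℕ} (P : MatPoly a N) (Q : MatPoly b N)
    (i : Fin a) (j : Fin b) : innerW s W P Q i j = hW.rowForm (P i) (Q j) := by
  simp [innerW, hW.rowForm_apply, rowIntegrand, Matrix.mul_apply, evalM]

lemma IsWeight.rowForm_mulX (hW : IsWeight s W) (p q : Fin N → ℂ[X]) :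
    hW.rowForm (mulX N p) q = hW.rowForm p (mulX N q) := by
  rw [hW.rowForm_apply, hW.rowForm_apply]
  congr 1; ext x
  simp only [rowIntegrand, Finset.sum_mul, mulX_apply]
  exact Finset.sum_congr rfl fun b _ => Finset.sum_congr rfl fun a _ => by simp; ring

lemma rowIntegrand_self (p : Fin N → ℂ[X]) (x : ℝ) :
    rowIntegrand W p p x =
      star (fun a => star ((p a).eval (x : ℂ))) ⬝ᵥ (W x *ᵥ fun a => star ((p a).eval (x : ℂ))) := by
  rw [Matrix.dotProduct_mulVec]
  simp [rowIntegrand, dotProduct, Matrix.vecMul]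

lemma IsWeight.eq_zero_of_rowForm_self_eq_zero (hW : IsWeight s W) (hs : IsOpen s)
    (hne : s.Nonempty) (p : Fin N → ℂ[X]) (h : hW.rowForm p p = 0) : p = 0 := by
  have hint := hW.integrableOn_rowIntegrand p p
  have hre : ∫ x in s, (rowIntegrand W p p x).re = 0 := by
    have := integral_re (𝕜 := ℂ) hint
    rw [← hW.rowForm_apply, h] at this
    simpa using this
  have hnn : 0 ≤ᵐ[volume.restrict s] fun x => (rowIntegrand W p p x).re := by
    filter_upwards [hW.posdef] with x hx
    rw [rowIntegrand_self]
    exact (Complex.le_def.1 (hx.posSemidef.dotProduct_mulVec_nonneg _)).1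
  have hz := (integral_eq_zero_iff_of_nonneg_ae hnn hint.re).1 hre
  have hp : ∀ᵐ x : ℝ ∂(volume.restrict s), ∀ a, (p a).eval (x : ℂ) = 0 := by
    filter_upwards [hz, hW.posdef] with x hx hpd a
    by_contra ha
    have hv : (fun a => star ((p a).eval (x : ℂ))) ≠ 0 := fun h0 =>
      ha (star_eq_zero.1 (congrFun h0 a))
    have := (Complex.lt_def.1 (hpd.dotProduct_mulVec_pos hv)).1
    rw [← rowIntegrand_self] at this
    exact this.ne' hx
  have hinf : {x : ℝ | ∀ a, (p a).eval (x : ℂ) = 0}.Infinite := fun hfin => by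
    have h1 : ∀ᵐ x ∂(volume.restrict s), x ∉ {x : ℝ | ∀ a, (p a).eval (x : ℂ) = 0} :=
      ae_restrict_of_ae (hfin.countable.ae_notMem volume)
    have h2 : ∀ᵐ x ∂(volume.restrict s), False := by
      filter_upwards [hp, h1] with x hx hx' using hx' hx
    rw [ae_iff] at h2
    simp only [not_false_eq_true, Set.ofPred_true, Measure.restrict_apply_univ] at h2
    exact (hs.measure_pos volume hne).ne' h2
  ext1 a
  refine Polynomial.eq_zero_of_infinite_isRoot _ ?_
  refine (hinf.image (Complex.ofReal_injective.injOn)).mono ?_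
  rintro _ ⟨x, hx, rfl⟩
  exact hx a

end Weight

section MOP

variable {s : Set ℝ} {N : ℕ} {W : ℝ → Matrix (Fin N) (Fin N) ℂ} {P : ℕ → MatPoly N N}

lemma coeff_sum_smul_row (P : MatPoly N N) (c : Fin N → ℂ) (a : Fin N) (k : ℕ) :
    ((∑ l, c l • P l) a).coeff k = ((c ᵥ* (Matrix.of fun i j => (P i j).coeff k)) : _ → ℂ) a := by
  simp [Matrix.vecMul, dotProduct, Finset.sum_apply, Polynomial.finsetSum_coeff]

lemma IsMOP.linearIndependent_row (hP : IsMOP s W P) (n : ℕ) :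
    LinearIndependent ℂ (fun i => P n i) := by
  rw [Fintype.linearIndependent_iff]
  intro c hc
  have h : c ᵥ* (Matrix.of fun i j => (P n i j).coeff n) =
      0 ᵥ* (Matrix.of fun i j => (P n i j).coeff n) := by
    ext a
    rw [← coeff_sum_smul_row, hc, Matrix.zero_vecMul]
    simp
  exact congrFun (Matrix.vecMul_injective_of_isUnit (hP.lead_unit n) h)

lemma IsMOP.mem_span_rows (hP : IsMOP s W P) (p : Fin N → ℂ[X]) :
    p ∈ Submodule.span ℂ {q | ∃ n i, P n i = q} := by
  have key : ∀ (n : ℕ) (p : Fin N → ℂ[X]), (∀ a k, n ≤ k → (p a).coeff k = 0) →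
      p ∈ Submodule.span ℂ {q | ∃ n i, P n i = q} := by
    intro n
    induction n with
    | zero =>
      intro p h
      have : p = 0 := by ext a k; simpa using h a k (Nat.zero_le k)
      rw [this]
      exact Submodule.zero_mem _
    | succ n ih =>
      intro p h
      obtain ⟨c, hc⟩ : ∃ c : Fin N → ℂ, c ᵥ* (Matrix.of fun i j => (P n i j).coeff n) =
          fun a => (p a).coeff n :=
        Matrix.vecMul_surjective_iff_isUnit.2 (hP.lead_unit n) _
      have hsum : (∑ l, c l • P n l) ∈ Submodule.span ℂ {q | ∃ n i, P n i = q} :=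
        Submodule.sum_mem _ fun l _ => Submodule.smul_mem _ _ (Submodule.subset_span ⟨n, l, rfl⟩)
      rw [← sub_add_cancel p (∑ l, c l • P n l)]
      refine Submodule.add_mem _ (ih _ fun a k hk => ?_) hsum
      rw [Pi.sub_apply, Polynomial.coeff_sub]
      rcases hk.eq_or_lt with rfl | hk
      · rw [coeff_sum_smul_row, hc, sub_self]
      · rw [h a k hk, coeff_sum_smul_row]
        simp [Matrix.vecMul, dotProduct,
          Polynomial.coeff_eq_zero_of_natDegree_lt ((hP.degree_le n _ _).trans_lt hk)]
  refine key (Finset.univ.sup (fun a => (p a).natDegree) + 1) p fun a k hk => ?_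
  refine Polynomial.coeff_eq_zero_of_natDegree_lt (lt_of_lt_of_le (Nat.lt_succ_of_le ?_) hk)
  exact Finset.le_sup (f := fun a => (p a).natDegree) (Finset.mem_univ a)

end MOP

lemma cmap_mul_row {n m k : ℕ} (A : Matrix (Fin n) (Fin m) ℂ) (Q : MatPoly m k) (i : Fin n) :
    (cmap A * Q) i = ∑ l, A i l • Q l := by
  ext1 a
  simp [Matrix.mul_apply, cmap, Finset.sum_apply, Polynomial.smul_eq_C_mul]

/-- the adjoint `V† = W̃ V* W⁻¹` maps `𝒟(W, W̃)` to `𝒟(W̃, W)`. -/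
theorem statement_6 {N1 N2 : ℕ} (s : Set ℝ) (hs : IsOpen s) (hconn : s.OrdConnected)
    (W : ℝ → Matrix (Fin N1) (Fin N1) ℂ) (Wt : ℝ → Matrix (Fin N2) (Fin N2) ℂ)
    (hW : IsWeight s W) (hWgood : GoodEnough s W)
    (hWt : IsWeight s Wt) (hWtgood : GoodEnough s Wt)
    (P : ℕ → MatPoly N1 N1) (Pt : ℕ → MatPoly N2 N2)
    (hP : IsMOP s W P) (hPt : IsMOP s Wt Pt)
    (V : MatDiffOp N1 N2) (hV : InDWW P Pt V) :
    ∃ Vd : MatDiffOp N2 N1,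
      (∀ (R : MatPoly N1 N1) (Q : MatPoly N2 N2),
        innerW s Wt (MatDiffOp.act R V) Q = innerW s W R (MatDiffOp.act Q Vd)) ∧
      InDWW Pt P Vd := by
  rcases s.eq_empty_or_nonempty with rfl | hne
  · have hact : ∀ Q : MatPoly N2 N2,
        MatDiffOp.act Q (⟨0, fun _ => 0, fun _ _ => rfl⟩ : MatDiffOp N2 N1) = 0 := fun Q => by
      simp [MatDiffOp.act]
    refine ⟨⟨0, fun _ => 0, fun _ _ => rfl⟩, fun R Q => ?_, fun n => ⟨0, ?_⟩⟩
    · ext i j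
      simp [innerW]
    · rw [hact]
      simp [cmap]
  have horth₁ : ∀ m n i j, m ≠ n → hW.rowForm (P m i) (P n j) = 0 := fun m n i j h => by
    rw [← hW.innerW_apply, hP.orthogonal m n h, Matrix.zero_apply]
  have horth₂ : ∀ m n i j, m ≠ n → hWt.rowForm (Pt m i) (Pt n j) = 0 := fun m n i j h => by
    rw [← hWt.innerW_apply, hPt.orthogonal m n h, Matrix.zero_apply]
  have hdef := hW.eq_zero_of_rowForm_self_eq_zero hs hne
  obtain ⟨S, hadj, hblock⟩ := exists_adjoint_of_block_diagonal hW.rowForm hWt.rowForm hdef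
    (fun n i => P n i) (fun n i => Pt n i) hP.linearIndependent_row hP.mem_span_rows
    hPt.mem_span_rows horth₁ horth₂ V.rowAct (fun n i => by
      obtain ⟨A, hA⟩ := hV n
      exact ⟨A i, by rw [← MatDiffOp.act_row, hA, cmap_mul_row]⟩)
  have hS : (adX N2 N1 ^ (V.order + 1)) S = 0 := by
    refine LinearMap.ext fun q => hdef _ ?_
    have := adX_pow_adjoint hW.rowForm hWt.rowForm hW.rowForm_mulX hWt.rowForm_mulX
      (V.order + 1) V.rowAct S hadj ((adX N2 N1 ^ (V.order + 1)) S q) q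
    rw [V.adX_pow_rowAct, LinearMap.zero_apply, map_zero, LinearMap.zero_apply] at this
    exact (mul_eq_zero.1 this.symm).resolve_left (pow_ne_zero _ (by norm_num))
  obtain ⟨Vd, hVd⟩ := exists_matDiffOp_of_adX_pow_eq_zero V.order S hS
  refine ⟨Vd, fun R Q => ?_, fun n => ?_⟩
  · ext i j
    rw [hWt.innerW_apply, hW.innerW_apply, MatDiffOp.act_row, MatDiffOp.act_row, hVd, hadj]
  · choose c hc using hblock n
    refine ⟨Matrix.of c, ?_⟩
    refine funext fun i => ?_
    rw [MatDiffOp.act_row, cmap_mul_row, hVd, hc]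
    rfl
end
end

section
/- Let w(x) = (1−x²)^{3/2} on (−1,1), let {p_n} be the monic orthogonal polynomials for w, let W(x) = (1−x²)^{1/2}·[[3, 3x, 4x²−1],[3x, x²+2, 3x],[4x²−1, 3x, 3]] on (−1,1), and let {P_n} be the monic MOP sequence for W. Consider the 1×3 row-vector differential operators D₁ = ∂·(x, −2, x) + (0, 0, 4), D₂ = ∂·(−1, 2x, −1) + (−1, 2, 1), and D₃ = (−1, 0, 1). Then for all n ≥ 0: p_n·D₁ = (n, 0, n+4)·P_n, p_n·D₂ = (−1, 2n+2, 1)·P_n, and p_n·D₃ = (−1, 0, 1)·P_n. Consequently, with V the 3×3 operator V = ∂·[[x, −2, x],[−1, 2x, −1],[0, 0, 0]] + [[0, 0, 4],[−1, 2, 1],[−1, 0, 1]] one has diag(p_n, p_n, p_n)·V = A_n·P_n with A_n = [[n, 0, n+4],[−1, 2n+2, 1],[−1, 0, 1]] invertible for every n ≥ 0, and therefore {P_n} is a Darboux transformation of {p_n ⊕ p_n ⊕ p_n}. -/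
open MeasureTheory Filter Polynomial Matrix
open scoped ComplexOrder

noncomputable section

/-- The first-order operator `∂ F₁ + F₀`. -/
def op1 {n m : ℕ} (F0 F1 : MatPoly n m) : MatDiffOp n m where
  order := 1
  coeff j := if j = 0 then F0 else if j = 1 then F1 else 0
  coeff_eq_zero j hj := by
    have h0 : j ≠ 0 := by omega
    have h1 : j ≠ 1 := by omega
    simp [h0, h1]

/-- The zeroth-order operator `F₀`. -/
def op0 {n m : ℕ} (F0 : MatPoly n m) : MatDiffOp n m where
  order := 0
  coeff j := if j = 0 then F0 else 0
  coeff_eq_zero j hj := by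
    have h0 : j ≠ 0 := by omega
    simp [h0]

/-- The scalar Jacobi weight `(1 - x²)^{3/2}` on `(-1, 1)`. -/
def jacw (x : ℝ) : ℝ := (1 - x ^ 2) ^ ((3 : ℝ) / 2)

/-- The 3×3 Jacobi-type matrix weight of Example 1. -/
def jacW (x : ℝ) : Matrix (Fin 3) (Fin 3) ℂ :=
  (((1 - x ^ 2) ^ ((1 : ℝ) / 2) : ℝ) : ℂ) •
    !![3, 3 * (x : ℂ), 4 * (x : ℂ) ^ 2 - 1;
       3 * (x : ℂ), (x : ℂ) ^ 2 + 2, 3 * (x : ℂ);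
       4 * (x : ℂ) ^ 2 - 1, 3 * (x : ℂ), 3]

/-- `p` is the sequence of monic orthogonal polynomials for `(1 - x²)^{3/2}` on `(-1, 1)`. -/
def IsJacobiSeq (p : ℕ → Polynomial ℂ) : Prop :=
  ∀ n : ℕ, (p n).Monic ∧ (p n).natDegree = n ∧
    ∀ k < n, ∫ x in Set.Ioo (-1 : ℝ) 1,
      (p n).eval (x : ℂ) * (x : ℂ) ^ k * ((jacw x : ℝ) : ℂ) = 0
/-- Coefficientwise complex conjugation of a polynomial. -/
def conjP (f : ℂ[X]) : ℂ[X] := f.map (starRingEnd ℂ)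

lemma eval_conjP (f : ℂ[X]) (x : ℝ) :
    (conjP f).eval (x : ℂ) = starRingEnd ℂ (f.eval (x : ℂ)) := by
  have h := Polynomial.eval_map_apply (f := starRingEnd ℂ) (p := f) (x : ℂ)
  rwa [Complex.conj_ofReal] at h

/-- The weight `(1 - x²)^{1/2}`. -/
def halfw (x : ℝ) : ℝ := (1 - x ^ 2) ^ ((1 : ℝ) / 2)

lemma continuous_halfw : Continuous halfw := by
  unfold halfw
  exact Continuous.rpow_const (by fun_prop) (fun _ => Or.inr (by norm_num))

lemma continuous_eval_ofReal (f : ℂ[X]) : Continuous fun x : ℝ => f.eval (x : ℂ) :=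
  f.continuous.comp Complex.continuous_ofReal

lemma continuous_eval_halfw (f : ℂ[X]) :
    Continuous fun x : ℝ => f.eval (x : ℂ) * (halfw x : ℂ) :=
  (continuous_eval_ofReal f).mul (Complex.continuous_ofReal.comp continuous_halfw)

lemma integrableOn_Ioo_of_continuous {E : Type*} [NormedAddCommGroup E] {f : ℝ → E}
    (hf : Continuous f) : IntegrableOn f (Set.Ioo (-1 : ℝ) 1) :=
  (hf.integrableOn_Icc).mono_set Set.Ioo_subset_Icc_self

/-- Integration of polynomials against `(1 - x²)^{1/2}` on `(-1, 1)`. -/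
def halfInt : ℂ[X] →ₗ[ℂ] ℂ where
  toFun f := ∫ x in Set.Ioo (-1 : ℝ) 1, f.eval (x : ℂ) * (halfw x : ℂ)
  map_add' f g := by
    rw [← integral_add (integrableOn_Ioo_of_continuous (continuous_eval_halfw f))
      (integrableOn_Ioo_of_continuous (continuous_eval_halfw g))]
    congr 1; ext x; simp [add_mul]
  map_smul' c f := by
    simp only [RingHom.id_apply, smul_eq_mul]
    rw [← integral_const_mul]
    congr 1; ext x; simp [mul_assoc]

lemma halfInt_apply (f : ℂ[X]) :
    halfInt f = ∫ x in Set.Ioo (-1 : ℝ) 1, f.eval (x : ℂ) * (halfw x : ℂ) := rfl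

lemma one_sub_sq_pos {x : ℝ} (hx : x ∈ Set.Ioo (-1 : ℝ) 1) : 0 < 1 - x ^ 2 := by
  nlinarith [hx.1, hx.2]

lemma jacw_eq {x : ℝ} (hx : 0 ≤ 1 - x ^ 2) : jacw x = (1 - x ^ 2) * halfw x := by
  unfold jacw halfw
  rw [show (3 : ℝ) / 2 = 1 + 1 / 2 by norm_num,
    Real.rpow_add_of_nonneg hx (by norm_num) (by norm_num), Real.rpow_one]

lemma hasDerivAt_jacw (x : ℝ) : HasDerivAt jacw (-3 * x * halfw x) x := by
  have h1 : HasDerivAt (fun y : ℝ => 1 - y ^ 2) (-(2 * x)) x := by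
    simpa using (hasDerivAt_pow 2 x).const_sub 1
  have h2 := h1.rpow_const (p := (3 : ℝ) / 2) (Or.inr (by norm_num))
  refine h2.congr_deriv ?_
  rw [halfw]
  rw [show (3 : ℝ) / 2 - 1 = 1 / 2 by norm_num]
  ring

/-- The integration by parts formula for the weight `(1 - x²)^{3/2}`. -/
lemma halfInt_exact (f : ℂ[X]) :
    halfInt ((1 - X ^ 2) * derivative f - 3 * X * f) = 0 := by
  have hd : ∀ x ∈ Set.uIcc (-1 : ℝ) 1,
      HasDerivAt (fun y : ℝ => f.eval (y : ℂ) * (jacw y : ℂ))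
        (((1 - X ^ 2) * derivative f - 3 * X * f).eval (x : ℂ) * (halfw x : ℂ)) x := by
    intro x hx
    rw [Set.uIcc_of_le (by norm_num)] at hx
    have h0 : 0 ≤ 1 - x ^ 2 := by nlinarith [hx.1, hx.2]
    have h1 := ((f.hasDerivAt (x : ℂ)).comp_ofReal).mul (hasDerivAt_jacw x).ofReal_comp
    refine h1.congr_deriv ?_
    rw [jacw_eq h0]
    simp
    ring
  have h := intervalIntegral.integral_eq_sub_of_hasDerivAt hd
    ((continuous_eval_halfw _).intervalIntegrable _ _)
  rw [halfInt_apply, ← integral_Ioc_eq_integral_Ioo,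
    ← intervalIntegral.integral_of_le (by norm_num), h]
  simp [jacw]

/-- A polynomial that is nonnegative on `(-1, 1)` and has zero integral vanishes. -/
lemma eq_zero_of_halfInt_eq_zero {f : ℂ[X]} {g : ℝ → ℝ} (hg : Continuous g)
    (hfg : ∀ x : ℝ, f.eval (x : ℂ) = g x) (hg0 : ∀ x ∈ Set.Ioo (-1 : ℝ) 1, 0 ≤ g x)
    (hf : halfInt f = 0) : ∀ x ∈ Set.Ioo (-1 : ℝ) 1, g x = 0 := by
  have hc : Continuous fun x => g x * halfw x := hg.mul continuous_halfw
  have hw : ∀ x ∈ Set.Ioo (-1 : ℝ) 1, 0 < halfw x := fun x hx =>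
    Real.rpow_pos_of_pos (one_sub_sq_pos hx) _
  have hI : ∫ x in Set.Ioo (-1 : ℝ) 1, g x * halfw x = 0 := by
    rw [halfInt_apply] at hf
    simp only [hfg, ← Complex.ofReal_mul] at hf
    rw [integral_complex_ofReal] at hf
    exact_mod_cast hf
  rw [setIntegral_eq_zero_iff_of_nonneg_ae
    ((ae_restrict_mem measurableSet_Ioo).mono fun x hx => mul_nonneg (hg0 x hx) (hw x hx).le)
    (integrableOn_Ioo_of_continuous hc)] at hI
  have h := Measure.eqOn_open_of_ae_eq hI isOpen_Ioo hc.continuousOn continuousOn_const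
  intro x hx
  exact (mul_eq_zero.1 (h hx)).resolve_right (hw x hx).ne'

lemma eq_zero_of_eval_Ioo {f : ℂ[X]}
    (h : ∀ x ∈ Set.Ioo (-1 : ℝ) 1, f.eval (x : ℂ) = 0) : f = 0 := by
  refine Polynomial.eq_zero_of_infinite_isRoot f ?_
  refine ((Set.Ioo_infinite (by norm_num : (-1 : ℝ) < 1)).image
    (f := fun x : ℝ => (x : ℂ)) Complex.ofReal_injective.injOn).mono ?_
  rintro _ ⟨x, hx, rfl⟩
  exact h x hx

/-- Orthogonality to the monomials `X^j`, `j < k`, gives orthogonality to degree `< k`. -/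
lemma halfInt_mul_eq_zero {f g : ℂ[X]} {k : ℕ} (h : ∀ j < k, halfInt (f * X ^ j) = 0)
    (hg : g.degree < k) : halfInt (f * g) = 0 := by
  rw [← mem_degreeLT, degreeLT_eq_span_X_pow] at hg
  induction hg using Submodule.span_induction with
  | mem y hy =>
    simp only [Finset.coe_image, Finset.coe_range, Set.mem_image, Set.mem_Iio] at hy
    obtain ⟨j, hj, rfl⟩ := hy
    exact h j hj
  | zero => simp
  | add a b _ _ ha hb => rw [mul_add, map_add, ha, hb, add_zero]
  | smul c a _ ha => rw [mul_smul_comm, map_smul, ha, smul_zero]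

lemma degree_lt_of_coeff_eq_zero {f : ℂ[X]} {n : ℕ} (h : f.natDegree ≤ n)
    (h0 : f.coeff n = 0) : f.degree < n := by
  rw [degree_lt_iff_coeff_zero]
  intro m hm
  rcases hm.lt_or_eq with hm | rfl
  · exact coeff_eq_zero_of_natDegree_lt (h.trans_lt hm)
  · exact h0

lemma natDegree_conjP_le (f : ℂ[X]) : (conjP f).natDegree ≤ f.natDegree :=
  natDegree_map_le

lemma degree_conjP_le (f : ℂ[X]) : (conjP f).degree ≤ f.degree :=
  degree_map_le

/-- The polynomial part of the weight `jacW`. -/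
def jacM : MatPoly 3 3 :=
  !![3, 3 * X, 4 * X ^ 2 - 1; 3 * X, X ^ 2 + 2, 3 * X; 4 * X ^ 2 - 1, 3 * X, 3]

lemma jacW_apply (x : ℝ) (i j : Fin 3) :
    jacW x i j = (jacM i j).eval (x : ℂ) * (halfw x : ℂ) := by
  unfold jacW jacM halfw
  fin_cases i <;> fin_cases j <;> simp [mul_comm]

lemma innerW_jacW_apply (P Q : MatPoly 3 3) (i j : Fin 3) :
    innerW (Set.Ioo (-1) 1) jacW P Q i j =
      halfInt (∑ b, (∑ a, P i a * jacM a b) * conjP (Q j b)) := by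
  rw [halfInt_apply, innerW, Matrix.of_apply]
  congr 1
  ext x
  simp only [Matrix.mul_apply, evalM, Matrix.of_apply, Matrix.conjTranspose_apply, jacW_apply,
    eval_finsetSum, eval_mul, eval_conjP, Finset.sum_mul]
  refine Finset.sum_congr rfl fun b _ => Finset.sum_congr rfl fun a _ => ?_
  simp only [starRingEnd_apply]
  ring

/-- The rows of a matrix orthogonal polynomial are orthogonal to the lower monomials. -/
lemma IsMOP.halfInt_mul_X_pow {P : ℕ → MatPoly 3 3} (hP : IsMOP (Set.Ioo (-1) 1) jacW P)
    (hPmonic : ∀ n, (Matrix.of fun i j : Fin 3 => ((P n) i j).coeff n)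
      = (1 : Matrix (Fin 3) (Fin 3) ℂ)) (n : ℕ) (i : Fin 3) :
    ∀ k < n, ∀ j, halfInt ((∑ a, P n i a * jacM a j) * X ^ k) = 0 := by
  intro k
  induction k using Nat.strong_induction_on with
  | _ k ih =>
    intro hk j
    have h := congr_fun (congr_fun (hP.orthogonal n k hk.ne') i) j
    rw [innerW_jacW_apply, map_sum] at h
    have hc : ∀ b, (P k j b).coeff k = (1 : Matrix (Fin 3) (Fin 3) ℂ) j b := fun b =>
      congr_fun (congr_fun (hPmonic k) j) b
    have hs : ∀ b, halfInt ((∑ a, P n i a * jacM a b) * conjP (P k j b)) =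
        if b = j then halfInt ((∑ a, P n i a * jacM a j) * X ^ k) else 0 := by
      intro b
      have hlow : halfInt ((∑ a, P n i a * jacM a b) *
          (conjP (P k j b) - C ((1 : Matrix (Fin 3) (Fin 3) ℂ) j b) * X ^ k)) = 0 := by
        refine halfInt_mul_eq_zero (k := k) (fun l hl => ih l hl (hl.trans hk) b) ?_
        refine degree_lt_of_coeff_eq_zero ?_ ?_
        · refine (natDegree_sub_le _ _).trans (max_le ?_ (natDegree_C_mul_X_pow_le _ _))
          exact (natDegree_conjP_le _).trans (hP.degree_le k j b)
        · simp only [coeff_sub, conjP, coeff_map, hc, coeff_C_mul, coeff_X_pow_self, mul_one]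
          by_cases hb : j = b <;> simp [Matrix.one_apply, hb]
      rw [mul_sub, map_sub, sub_eq_zero] at hlow
      rw [hlow]
      by_cases hb : b = j
      · subst hb; simp
      · simp [hb, Ne.symm hb]
    simp only [hs, Finset.sum_ite_eq', Finset.mem_univ, if_true] at h
    simpa using h

/-- Nondegeneracy of the inner product of `jacW` on row polynomials of degree `< n`. -/
lemma row_eq_zero {R : Fin 3 → ℂ[X]} {n : ℕ} (hdeg : ∀ j, (R j).degree < n)
    (horth : ∀ k < n, ∀ j, halfInt ((∑ a, R a * jacM a j) * X ^ k) = 0) : ∀ j, R j = 0 := by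
  have h0 : halfInt (∑ b, (∑ a, R a * jacM a b) * conjP (R b)) = 0 := by
    rw [map_sum]
    exact Finset.sum_eq_zero fun b _ => halfInt_mul_eq_zero (fun k hk => horth k hk b)
      ((degree_conjP_le _).trans_lt (hdeg b))
  have hz := eq_zero_of_halfInt_eq_zero (g := fun x : ℝ =>
    Complex.normSq ((R 0 + X * R 1 + R 2).eval (x : ℂ)) +
      2 * Complex.normSq ((X * R 0 + R 1 + X * R 2).eval (x : ℂ)) +
      2 * (1 - x ^ 2) * Complex.normSq ((R 2 - R 0).eval (x : ℂ)))
    (by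
      have hc : ∀ f : ℂ[X], Continuous fun x : ℝ => Complex.normSq (f.eval (x : ℂ)) := fun f =>
        Complex.continuous_normSq.comp (continuous_eval_ofReal f)
      exact ((hc _).add (continuous_const.mul (hc _))).add
        ((by fun_prop : Continuous fun x : ℝ => 2 * (1 - x ^ 2)).mul (hc _)))
    (by
      intro x
      simp only [Complex.ofReal_add, Complex.ofReal_mul, Complex.ofReal_sub, Complex.ofReal_pow,
        Complex.ofReal_one, Complex.ofReal_ofNat, Complex.normSq_eq_conj_mul_self,
        Fin.sum_univ_three, eval_add, eval_mul, eval_sub, eval_X, eval_conjP, map_add, map_mul,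
        map_sub, Complex.conj_ofReal]
      simp [jacM]
      ring)
    (by
      intro x hx
      have := one_sub_sq_pos hx
      have := Complex.normSq_nonneg ((R 0 + X * R 1 + R 2).eval (x : ℂ))
      have := Complex.normSq_nonneg ((X * R 0 + R 1 + X * R 2).eval (x : ℂ))
      have := Complex.normSq_nonneg ((R 2 - R 0).eval (x : ℂ))
      positivity)
    h0
  have hev : ∀ x ∈ Set.Ioo (-1 : ℝ) 1, ∀ j, (R j).eval (x : ℂ) = 0 := by
    intro x hx
    have hp := one_sub_sq_pos hx
    have h1 := Complex.normSq_nonneg ((R 0 + X * R 1 + R 2).eval (x : ℂ))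
    have h2 := Complex.normSq_nonneg ((X * R 0 + R 1 + X * R 2).eval (x : ℂ))
    have h3 := Complex.normSq_nonneg ((R 2 - R 0).eval (x : ℂ))
    have h4 := mul_nonneg hp.le h3
    have hs := hz x hx
    have e1 : Complex.normSq ((R 0 + X * R 1 + R 2).eval (x : ℂ)) = 0 := by nlinarith
    have e2 : Complex.normSq ((X * R 0 + R 1 + X * R 2).eval (x : ℂ)) = 0 := by nlinarith
    have e3 : (1 - x ^ 2) * Complex.normSq ((R 2 - R 0).eval (x : ℂ)) = 0 := by nlinarith
    replace e3 := (mul_eq_zero.1 e3).resolve_left hp.ne'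
    rw [Complex.normSq_eq_zero] at e1 e2 e3
    simp only [eval_add, eval_mul, eval_sub, eval_X] at e1 e2 e3
    have hx0 : (1 - (x : ℂ) ^ 2) ≠ 0 := by exact_mod_cast hp.ne'
    have r1 : (R 1).eval (x : ℂ) = 0 := by
      refine (mul_eq_zero.1 (?_ : (1 - (x : ℂ) ^ 2) * _ = 0)).resolve_left hx0
      linear_combination e2 - (x : ℂ) * e1
    have r0 : (R 0).eval (x : ℂ) = 0 := by
      linear_combination (1 / 2) * e1 - (1 / 2) * e3 - (x : ℂ) / 2 * r1
    have r2 : (R 2).eval (x : ℂ) = 0 := by linear_combination e3 + r0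
    intro j
    fin_cases j
    · exact r0
    · exact r1
    · exact r2
  exact fun j => eq_zero_of_eval_Ioo fun x hx => hev x hx j

lemma coeff_X_mul_derivative (f : ℂ[X]) (m : ℕ) :
    (X * derivative f).coeff m = m * f.coeff m := by
  cases m with
  | zero => simp
  | succ m => rw [coeff_X_mul, coeff_derivative]; push_cast; ring

/-- The action of `(1 - x²) ∂² - 5 x ∂` on coefficients. -/
lemma coeff_jacobi (f : ℂ[X]) (m : ℕ) :
    ((1 - X ^ 2) * derivative (derivative f) - 5 * X * derivative f).coeff m =
      (m + 2) * (m + 1) * f.coeff (m + 2) - m * (m + 4) * f.coeff m := by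
  have h : (1 - X ^ 2) * derivative (derivative f) - 5 * X * derivative f =
      derivative (derivative f) - X * derivative (X * derivative f)
        - C 4 * (X * derivative f) := by
    rw [show (C 4 : ℂ[X]) = 4 from rfl, derivative_mul, derivative_X]
    ring
  rw [h, coeff_sub, coeff_sub, coeff_C_mul, coeff_X_mul_derivative, coeff_X_mul_derivative,
    coeff_derivative, coeff_derivative]
  push_cast
  ring

lemma IsJacobiSeq.coeff_self {p : ℕ → ℂ[X]} (hp : IsJacobiSeq p) (n : ℕ) :
    (p n).coeff n = 1 := by
  have := (hp n).1.coeff_natDegree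
  rwa [(hp n).2.1] at this

lemma IsJacobiSeq.coeff_of_lt {p : ℕ → ℂ[X]} (hp : IsJacobiSeq p) {n m : ℕ} (h : n < m) :
    (p n).coeff m = 0 :=
  coeff_eq_zero_of_natDegree_lt ((hp n).2.1.trans_lt h)

lemma IsJacobiSeq.halfInt_mul_eq_zero {p : ℕ → ℂ[X]} (hp : IsJacobiSeq p) {n : ℕ}
    {g : ℂ[X]} (hg : g.degree < n) :
    halfInt (p n * (1 - X ^ 2) * g) = 0 := by
  refine _root_.halfInt_mul_eq_zero (fun k hk => ?_) hg
  rw [← (hp n).2.2 k hk, halfInt_apply]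
  refine setIntegral_congr_fun measurableSet_Ioo fun x hx => ?_
  simp only [jacw_eq (one_sub_sq_pos hx).le]
  simp
  ring

/-- If `v = p' F₁ M + p F₀ M` with `F₁ M = -(1 - X²) u` and `F₀ M = 3 X u + (1 - X²) c`, then
`v` is orthogonal to the monomials of degree `< n`. -/
lemma IsJacobiSeq.halfInt_firstOrder {p : ℕ → ℂ[X]} (hp : IsJacobiSeq p) {n k : ℕ}
    (hk : k < n) {u c : ℂ[X]} (hu : u.natDegree ≤ 1) (hc : c.natDegree ≤ 0) :
    halfInt ((derivative (p n) * (-(1 - X ^ 2) * u) + p n * (3 * X * u + (1 - X ^ 2) * c))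
      * X ^ k) = 0 := by
  have hg : (derivative (u * X ^ k) + c * X ^ k).degree < (n : WithBot ℕ) := by
    refine degree_le_natDegree.trans_lt (WithBot.coe_lt_coe.2 (lt_of_le_of_lt ?_ hk))
    refine (natDegree_add_le _ _).trans (max_le ?_ ?_)
    · refine (natDegree_derivative_le _).trans ?_
      have : (u * X ^ k).natDegree ≤ 1 + k :=
        natDegree_mul_le.trans (add_le_add hu (natDegree_X_pow_le k))
      omega
    · exact natDegree_mul_le.trans ((add_le_add hc (natDegree_X_pow_le k)).trans (by omega))
  have h1 := hp.halfInt_mul_eq_zero hg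
  have h2 := halfInt_exact (p n * (u * X ^ k))
  rw [← sub_eq_zero.2 (h1.trans h2.symm), ← map_sub]
  congr 1
  rw [derivative_mul (f := p n)]
  ring

/-- The Jacobi differential equation. -/
lemma IsJacobiSeq.differential_eq {p : ℕ → ℂ[X]} (hp : IsJacobiSeq p) (n : ℕ) :
    (1 - X ^ 2) * derivative (derivative (p n)) - 5 * X * derivative (p n) =
      -C ((n : ℂ) * (n + 4)) * p n := by
  set q := (1 - X ^ 2) * derivative (derivative (p n)) - 5 * X * derivative (p n)
    + C ((n : ℂ) * (n + 4)) * p n with hq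
  have hdeg : q.degree < n := by
    rw [degree_lt_iff_coeff_zero]
    intro m hm
    rw [hq, coeff_add, coeff_jacobi, coeff_C_mul, hp.coeff_of_lt (by omega : n < m + 2)]
    rcases hm.lt_or_eq with hm | rfl
    · rw [hp.coeff_of_lt hm]; ring
    · ring
  have horth : ∀ g : ℂ[X], g.degree < n → halfInt (q * (1 - X ^ 2) * g) = 0 := by
    intro g hg
    have hL : ((1 - X ^ 2) * derivative (derivative g) - 5 * X * derivative g).degree
        < (n : WithBot ℕ) := by
      rw [degree_lt_iff_coeff_zero] at hg ⊢
      intro m hm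
      rw [coeff_jacobi, hg m hm, hg (m + 2) (by omega)]
      ring
    have h1 := halfInt_exact ((1 - X ^ 2) * derivative (p n) * g)
    have h2 := halfInt_exact ((1 - X ^ 2) * p n * derivative g)
    have h3 := hp.halfInt_mul_eq_zero hL
    have h4 : halfInt (C ((n : ℂ) * (n + 4)) * (p n * (1 - X ^ 2) * g)) = 0 := by
      rw [← smul_eq_C_mul, map_smul, hp.halfInt_mul_eq_zero hg, smul_zero]
    have h5 : q * (1 - X ^ 2) * g =
        ((1 - X ^ 2) * derivative ((1 - X ^ 2) * derivative (p n) * g)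
          - 3 * X * ((1 - X ^ 2) * derivative (p n) * g))
        - ((1 - X ^ 2) * derivative ((1 - X ^ 2) * p n * derivative g)
          - 3 * X * ((1 - X ^ 2) * p n * derivative g))
        + p n * (1 - X ^ 2) *
          ((1 - X ^ 2) * derivative (derivative g) - 5 * X * derivative g)
        + C ((n : ℂ) * (n + 4)) * (p n * (1 - X ^ 2) * g) := by
      rw [hq]
      simp only [derivative_mul, derivative_sub, derivative_one, derivative_X_pow]
      simp only [Nat.cast_ofNat, show (2 : ℕ) - 1 = 1 from rfl, pow_one,
        show (C 2 : ℂ[X]) = 2 from rfl]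
      ring
    rw [h5, map_add, map_add, map_sub, h1, h2, h3, h4]
    simp
  have h0 := horth (conjP q) ((degree_conjP_le _).trans_lt hdeg)
  have hz := eq_zero_of_halfInt_eq_zero (g := fun x : ℝ =>
      (1 - x ^ 2) * Complex.normSq (q.eval (x : ℂ)))
    ((by fun_prop : Continuous fun x : ℝ => 1 - x ^ 2).mul
      (Complex.continuous_normSq.comp (continuous_eval_ofReal q)))
    (by
      intro x
      simp only [Complex.ofReal_mul, Complex.normSq_eq_conj_mul_self, eval_mul, eval_conjP]
      simp
      ring)
    (fun x hx => mul_nonneg (one_sub_sq_pos hx).le (Complex.normSq_nonneg _)) h0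
  have hq0 : q = 0 := eq_zero_of_eval_Ioo fun x hx =>
    Complex.normSq_eq_zero.1 ((mul_eq_zero.1 (hz x hx)).resolve_left (one_sub_sq_pos hx).ne')
  rw [hq] at hq0
  linear_combination hq0

/-- A first-order row operator compatible with both weights maps `p n` to a row of `P n`. -/
lemma IsJacobiSeq.row_eq {p : ℕ → ℂ[X]} (hp : IsJacobiSeq p) {P : ℕ → MatPoly 3 3}
    (hP : IsMOP (Set.Ioo (-1) 1) jacW P)
    (hPmonic : ∀ n, (Matrix.of fun i j : Fin 3 => ((P n) i j).coeff n)
      = (1 : Matrix (Fin 3) (Fin 3) ℂ)) (n : ℕ) (s t b : Fin 3 → ℂ) (u c : Fin 3 → ℂ[X])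
    (hu : ∀ j, (u j).natDegree ≤ 1) (hc : ∀ j, (c j).natDegree ≤ 0)
    (hF1 : ∀ j, ∑ a, (C (s a) * X + C (t a)) * jacM a j = -(1 - X ^ 2) * u j)
    (hF0 : ∀ j, ∑ a, C (b a) * jacM a j = 3 * X * u j + (1 - X ^ 2) * c j) (j : Fin 3) :
    derivative (p n) * (C (s j) * X + C (t j)) + p n * C (b j) =
      ∑ i, C (n * s i + b i) * P n i j := by
  have hPc : ∀ i j, (P n i j).coeff n = (1 : Matrix (Fin 3) (Fin 3) ℂ) i j := fun i j =>
    congr_fun (congr_fun (hPmonic n) i) j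
  have key := row_eq_zero (n := n) (R := fun j =>
    derivative (p n) * (C (s j) * X + C (t j)) + p n * C (b j)
      - ∑ i, C (n * s i + b i) * P n i j) ?_ ?_ j
  · exact sub_eq_zero.1 key
  · intro j
    rw [degree_lt_iff_coeff_zero]
    intro m hm
    have he : derivative (p n) * (C (s j) * X + C (t j)) + p n * C (b j)
        = C (s j) * (X * derivative (p n)) + C (t j) * derivative (p n) + C (b j) * p n := by
      ring
    rw [coeff_sub, he, coeff_add, coeff_add, coeff_C_mul, coeff_C_mul, coeff_C_mul,
      coeff_X_mul_derivative, coeff_derivative, hp.coeff_of_lt (by omega : n < m + 1),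
      finsetSum_coeff]
    simp only [coeff_C_mul]
    rcases hm.lt_or_eq with hm | rfl
    · have : ∀ i, (P n i j).coeff m = 0 := fun i =>
        coeff_eq_zero_of_natDegree_lt ((hP.degree_le n i j).trans_lt hm)
      simp [hp.coeff_of_lt hm, this]
    · simp [hPc, hp.coeff_self, Matrix.one_apply]
      ring
  · intro k hk l
    have h1 := hp.halfInt_firstOrder hk (hu l) (hc l)
    rw [← hF1, ← hF0] at h1
    have h2 : ∀ i, halfInt (C (n * s i + b i) * ((∑ a, P n i a * jacM a l) * X ^ k)) = 0 := by
      intro i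
      rw [← smul_eq_C_mul, map_smul, hP.halfInt_mul_X_pow hPmonic n i k hk l, smul_zero]
    have h3 : (∑ a, (derivative (p n) * (C (s a) * X + C (t a)) + p n * C (b a)
        - ∑ i, C (n * s i + b i) * P n i a) * jacM a l) * X ^ k =
        (derivative (p n) * ∑ a, (C (s a) * X + C (t a)) * jacM a l
          + p n * ∑ a, C (b a) * jacM a l) * X ^ k
        - ∑ i, C (n * s i + b i) * ((∑ a, P n i a * jacM a l) * X ^ k) := by
      simp only [Fin.sum_univ_three]
      ring
    rw [h3, map_sub, h1, map_sum, Finset.sum_eq_zero fun i _ => h2 i, sub_zero]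

/-- The second-order operator `∂² F₂ + ∂ F₁ + F₀`. -/
def op2 {n m : ℕ} (F0 F1 F2 : MatPoly n m) : MatDiffOp n m where
  order := 2
  coeff j := if j = 0 then F0 else if j = 1 then F1 else if j = 2 then F2 else 0
  coeff_eq_zero j hj := by
    have h0 : j ≠ 0 := by omega
    have h1 : j ≠ 1 := by omega
    have h2 : j ≠ 2 := by omega
    simp [h0, h1, h2]

lemma act_op0_apply {k n m : ℕ} (R : MatPoly k n) (F0 : MatPoly n m) (i : Fin k) (j : Fin m) :
    MatDiffOp.act R (op0 F0) i j = ∑ a, R i a * F0 a j := by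
  simp [MatDiffOp.act, op0, derivM, Matrix.mul_apply]

lemma act_op1_apply {k n m : ℕ} (R : MatPoly k n) (F0 F1 : MatPoly n m) (i : Fin k)
    (j : Fin m) :
    MatDiffOp.act R (op1 F0 F1) i j = ∑ a, (derivative (R i a) * F1 a j + R i a * F0 a j) := by
  simp [MatDiffOp.act, op1, derivM, Matrix.mul_apply, Finset.sum_range_succ,
    Finset.sum_add_distrib, add_comm]

lemma act_op2_apply {k n m : ℕ} (R : MatPoly k n) (F0 F1 F2 : MatPoly n m) (i : Fin k)
    (j : Fin m) :
    MatDiffOp.act R (op2 F0 F1 F2) i j =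
      ∑ a, (derivative (derivative (R i a)) * F2 a j + derivative (R i a) * F1 a j
        + R i a * F0 a j) := by
  simp [MatDiffOp.act, op2, derivM, Matrix.mul_apply, Finset.sum_range_succ,
    Finset.sum_add_distrib]
  ring

/-- A first-order operator `∂ F₁ + F₀` with `deg F₁ ≤ 1`, `deg F₀ ≤ 0` is degree-preserving as
soon as some entry of it is multiplication by a nonzero constant. -/
lemma degreePreserving_op1 {n m : ℕ} {F0 F1 : MatPoly n m} (h0 : ∀ i j, (F0 i j).natDegree ≤ 0)
    (h1 : ∀ i j, (F1 i j).natDegree ≤ 1) {i : Fin n} {j : Fin m} (hF1 : F1 i j = 0)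
    (hF0 : (F0 i j).degree = 0) : DegreePreserving (op1 F0 F1) := by
  have hs : ∀ (f : ℂ[X]) i j, (op1 F0 F1).sact f i j = f * F0 i j + derivative f * F1 i j := by
    intro f i j
    simp [MatDiffOp.sact, op1, Finset.sum_range_succ]
  refine Filter.Eventually.of_forall fun d f hf => ⟨fun i j => ?_, i, j, ?_⟩
  · rw [hs]
    refine (degree_add_le _ _).trans (max_le ?_ ?_)
    · rw [degree_mul, hf]
      simpa using add_le_add_right (natDegree_le_iff_degree_le.1 (h0 i j)) (d : WithBot ℕ)
    · by_cases hz : derivative f = 0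
      · simp [hz]
      have hne : f.natDegree ≠ 0 := fun h => hz (derivative_of_natDegree_zero h)
      have hd : f.natDegree = d := natDegree_eq_of_degree_eq_some hf
      rw [degree_mul, degree_eq_natDegree hz]
      have h2 := natDegree_derivative_lt hne
      calc ((derivative f).natDegree : WithBot ℕ) + (F1 i j).degree
          ≤ ((derivative f).natDegree : WithBot ℕ) + 1 := by 
            gcongr; exact natDegree_le_iff_degree_le.1 (h1 i j)
        _ ≤ d := by exact_mod_cast (by omega : (derivative f).natDegree + 1 ≤ d)
  · rw [hs, hF1, mul_zero, add_zero, degree_mul, hf, hF0, add_zero]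

/-- the explicit Darboux transformation of Example 1. -/
theorem statement_13 (p : ℕ → Polynomial ℂ) (hp : IsJacobiSeq p)
    (P : ℕ → MatPoly 3 3) (hP : IsMOP (Set.Ioo (-1) 1) jacW P)
    (hPmonic : ∀ n, (Matrix.of fun i j : Fin 3 => ((P n) i j).coeff n)
      = (1 : Matrix (Fin 3) (Fin 3) ℂ)) :
    (∀ n : ℕ, MatDiffOp.act !![p n] (op1 !![0, 0, 4] !![X, -2, X])
        = cmap !![(n : ℂ), 0, (n : ℂ) + 4] * P n) ∧
    (∀ n : ℕ, MatDiffOp.act !![p n] (op1 !![-1, 2, 1] !![-1, 2 * X, -1])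
        = cmap !![-1, 2 * (n : ℂ) + 2, 1] * P n) ∧
    (∀ n : ℕ, MatDiffOp.act !![p n] (op0 !![-1, 0, 1])
        = cmap !![-1, 0, 1] * P n) ∧
    (∀ n : ℕ,
      MatDiffOp.act (Matrix.diagonal fun _ : Fin 3 => p n)
          (op1 !![0, 0, 4; -1, 2, 1; -1, 0, 1] !![X, -2, X; -1, 2 * X, -1; 0, 0, 0])
        = cmap !![(n : ℂ), 0, (n : ℂ) + 4; -1, 2 * (n : ℂ) + 2, 1; -1, 0, 1] * P n ∧
      IsUnit !![(n : ℂ), 0, (n : ℂ) + 4; -1, 2 * (n : ℂ) + 2, 1; -1, 0, 1]) ∧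
    IsDarboux (fun n => Matrix.diagonal fun _ : Fin 3 => p n) P := by
  have e1 := fun n => hp.row_eq hP hPmonic n ![1, 0, 1] ![0, -2, 0] ![0, 0, 4]
    ![C 4 * X, C 4, C 4 * X] ![C (-4), 0, C 12]
    (by intro j; fin_cases j <;> simp)
    (by intro j; fin_cases j <;> simp)
    (by intro j; fin_cases j <;> simp [Fin.sum_univ_three, jacM, C_ofNat] <;> ring)
    (by intro j; fin_cases j <;> simp [Fin.sum_univ_three, jacM, C_ofNat] <;> ring)
  have e2 := fun n => hp.row_eq hP hPmonic n ![0, 2, 0] ![-1, 0, -1] ![-1, 2, 1]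
    ![C 2, C 2 * X, C 2] ![C (-4), C 4, C 4]
    (by intro j; fin_cases j <;> simp)
    (by intro j; fin_cases j <;> simp)
    (by intro j; fin_cases j <;> simp [Fin.sum_univ_three, jacM, C_ofNat] <;> ring)
    (by intro j; fin_cases j <;> simp [Fin.sum_univ_three, jacM, C_ofNat] <;> ring)
  have e3 := fun n => hp.row_eq hP hPmonic n 0 0 ![-1, 0, 1] 0 ![C (-4), 0, C 4]
    (by intro j; simp)
    (by intro j; fin_cases j <;> simp)
    (by intro j; simp)
    (by intro j; fin_cases j <;> simp [Fin.sum_univ_three, jacM, C_ofNat] <;> ring)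
  have hV : ∀ n, MatDiffOp.act (Matrix.diagonal fun _ : Fin 3 => p n)
      (op1 !![0, 0, 4; -1, 2, 1; -1, 0, 1] !![X, -2, X; -1, 2 * X, -1; 0, 0, 0])
        = cmap !![(n : ℂ), 0, (n : ℂ) + 4; -1, 2 * (n : ℂ) + 2, 1; -1, 0, 1] * P n := by
    intro n
    ext1 i j
    rw [act_op1_apply]
    have f1 := e1 n j
    have f2 := e2 n j
    have f3 := e3 n j
    fin_cases i
    · fin_cases j <;> simp [Fin.sum_univ_three, cmap, Matrix.mul_apply, C_ofNat] at f1 ⊢ <;>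
        linear_combination f1
    · fin_cases j <;> simp [Fin.sum_univ_three, cmap, Matrix.mul_apply, C_ofNat] at f2 ⊢ <;>
        linear_combination f2
    · fin_cases j <;> simp [Fin.sum_univ_three, cmap, Matrix.mul_apply] at f3 ⊢ <;>
        linear_combination f3
  refine ⟨fun n => ?_, fun n => ?_, fun n => ?_, fun n => ⟨hV n, ?_⟩, ?_⟩
  · ext1 i j
    rw [act_op1_apply]
    have f := e1 n j
    fin_cases i
    fin_cases j <;> simp [Fin.sum_univ_three, cmap, Matrix.mul_apply, C_ofNat] at f ⊢ <;>
      linear_combination f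
  · ext1 i j
    rw [act_op1_apply]
    have f := e2 n j
    fin_cases i
    fin_cases j <;> simp [Fin.sum_univ_three, cmap, Matrix.mul_apply, C_ofNat] at f ⊢ <;>
      linear_combination f
  · ext1 i j
    rw [act_op0_apply]
    have f := e3 n j
    fin_cases i
    fin_cases j <;> simp [Fin.sum_univ_three, cmap, Matrix.mul_apply] at f ⊢ <;>
      linear_combination f
  · rw [Matrix.isUnit_iff_isUnit_det, isUnit_iff_ne_zero, Matrix.det_fin_three]
    have h : (((2 * n + 2) * (2 * n + 4) : ℕ) : ℂ) ≠ 0 := Nat.cast_ne_zero.2 (by positivity)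
    push_cast at h
    simp
    intro h'
    apply h
    linear_combination h'
  · refine ⟨op1 !![0, 0, 4; -1, 2, 1; -1, 0, 1] !![X, -2, X; -1, 2 * X, -1; 0, 0, 0],
      op1 !![0, -4, -4; 0, 6, 0; 16, 4, 4] !![4 * X, 2, 0; 4, 2 * X, 0; 4 * X, 2, 0],
      op2 !![64, 16, 16; 16, 20, 8; 16, 8, 8] !![40 * X, 0, 0; 0, 20 * X, 0; 0, 0, 0]
        !![-8 * (1 - X ^ 2), 0, 0; 0, -4 * (1 - X ^ 2), 0; 0, 0, 0],
      fun n => !![(n : ℂ), 0, (n : ℂ) + 4; -1, 2 * (n : ℂ) + 2, 1; -1, 0, 1],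
      ?_, ?_, ?_, ?_, hV⟩
    · refine degreePreserving_op1 (i := 2) (j := 2) ?_ ?_ ?_ ?_
      · intro i j; fin_cases i <;> fin_cases j <;> simp
      · intro i j; fin_cases i <;> fin_cases j <;> simp
      · simp
      · simp
    · refine degreePreserving_op1 (i := 2) (j := 2) ?_ ?_ ?_ ?_
      · intro i j; fin_cases i <;> fin_cases j <;> simp
      · intro i j; fin_cases i <;> fin_cases j <;> simp
      · simp
      · simp
        compute_degree!
    · intro R
      ext1 i j
      rw [act_op2_apply, act_op1_apply]
      simp only [act_op1_apply]
      fin_cases j <;> simp [Fin.sum_univ_three] <;> ring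
    · intro n
      refine ⟨!![8 * (n * (n + 4)) + 64, 16, 16; 16, 4 * (n * (n + 4)) + 20, 8; 16, 8, 8], ?_⟩
      have h := hp.differential_eq n
      ext1 i j
      rw [act_op2_apply]
      fin_cases i <;> fin_cases j <;>
        simp [Fin.sum_univ_three, cmap, Matrix.mul_apply, C_ofNat] at h ⊢
      all_goals
        first
        | ring1
        | linear_combination -8 * h
        | linear_combination -4 * h
end
end
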